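/- arXiv:2309.17079 — 3 statements merged into one kernel-verified Lean document; each statement's English description precedes it below -/
import Mathlib

section
/- Let U_r be a deterministic N_r × n_r complex matrix and U_s a deterministic N_s × n_s complex matrix, and define the random channel matrix H(ω) = U_r · (Q ⊙ W(ω)) · U_sᴴ. Then the full correlation matrix R, defined entrywise by R (j,i) (l,k) = ∫ H(ω) i j · conj(H(ω) k l) dμ(ω) for (j,i),(l,k) ∈ Fin N_s × Fin N_r (i.e. R = E[vec(H)·vec(H)ᴴ]), equals (conj(U_s) ⊗ U_r) · (diag(v_s⊙v_s) ⊗ diag(v_r⊙v_r)) · (U_sᵀ ⊗ U_rᴴ). -/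
open MeasureTheory Matrix
open scoped Matrix Kronecker

/-- The cross-correlation of two linear combinations of an uncorrelated family of unit-variance
variables is the Hermitian product of their coefficient vectors. -/
theorem integral_sum_mul_star_sum_of_white {Ω ι : Type*} [MeasurableSpace Ω] [Fintype ι]
    [DecidableEq ι] {μ : Measure Ω} {w : ι → Ω → ℂ}
    (hint : ∀ x y, Integrable (fun ω => w x ω * star (w y ω)) μ)
    (hwhite : ∀ x y, ∫ ω, w x ω * star (w y ω) ∂μ = if x = y then 1 else 0) (a b : ι → ℂ) :
    ∫ ω, (∑ x, a x * w x ω) * star (∑ y, b y * w y ω) ∂μ = ∑ x, a x * star (b x) := by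
  have expand : ∀ ω, (∑ x, a x * w x ω) * star (∑ y, b y * w y ω) =
      ∑ x, ∑ y, a x * star (b y) * (w x ω * star (w y ω)) := by
    intro ω
    rw [star_sum, Finset.sum_mul_sum]
    refine Finset.sum_congr rfl fun x _ => Finset.sum_congr rfl fun y _ => ?_
    rw [star_mul']
    ring
  simp_rw [expand]
  rw [integral_finsetSum _ fun x _ =>
    integrable_finsetSum _ fun y _ => (hint x y).const_mul _]
  refine Finset.sum_congr rfl fun x _ => ?_
  rw [integral_finsetSum _ fun y _ => (hint x y).const_mul _]
  simp_rw [integral_const_mul, hwhite]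
  simp

/-- Full correlation matrix of the channel `H(ω) = U_r (Q ⊙ W(ω)) U_sᴴ` (equation (8)):
with `R (j,i) (l,k) = E[H i j * conj(H k l)]` (i.e. `R = E[vec(H) vec(H)ᴴ]`), one has
`R = (conj(U_s) ⊗ U_r) (diag(v_s⊙v_s) ⊗ diag(v_r⊙v_r)) (U_sᵀ ⊗ U_rᴴ)`. -/
theorem full_correlation_matrix
    {Ω : Type*} [MeasurableSpace Ω] (μ : Measure Ω) [IsProbabilityMeasure μ]
    {n_r n_s N_r N_s : ℕ} (v_r : Fin n_r → ℝ) (v_s : Fin n_s → ℝ)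
    (Q : Matrix (Fin n_r) (Fin n_s) ℂ)
    (hQ : ∀ i j, Q i j = (v_r i : ℂ) * (v_s j : ℂ))
    (W : Ω → Matrix (Fin n_r) (Fin n_s) ℂ)
    (hmeas : ∀ i j, Measurable fun ω => W ω i j)
    (hint : ∀ i j k l, Integrable (fun ω => W ω i j * star (W ω k l)) μ)
    (hwhite : ∀ i j k l,
      ∫ ω, W ω i j * star (W ω k l) ∂μ = if (i, j) = (k, l) then 1 else 0)
    (U_r : Matrix (Fin N_r) (Fin n_r) ℂ) (U_s : Matrix (Fin N_s) (Fin n_s) ℂ)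
    (H : Ω → Matrix (Fin N_r) (Fin N_s) ℂ)
    (hH : ∀ ω, H ω = U_r * (Q ⊙ W ω) * U_sᴴ) :
    (Matrix.of fun (p q : Fin N_s × Fin N_r) =>
        ∫ ω, H ω p.2 p.1 * star (H ω q.2 q.1) ∂μ) =
      (U_s.map star ⊗ₖ U_r) *
        (Matrix.diagonal (fun j => (v_s j : ℂ) ^ 2) ⊗ₖ
          Matrix.diagonal (fun i => (v_r i : ℂ) ^ 2)) *
        (U_sᵀ ⊗ₖ U_rᴴ) := by
  have entry : ∀ ω (p : Fin N_s × Fin N_r), H ω p.2 p.1 =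
      ∑ x : Fin n_s × Fin n_r,
        (star (U_s p.1 x.1) * U_r p.2 x.2 * ((v_s x.1 : ℂ) * (v_r x.2 : ℂ))) * W ω x.2 x.1 := by
    intro ω p
    rw [hH, Matrix.mul_apply, Fintype.sum_prod_type]
    refine Finset.sum_congr rfl fun j _ => ?_
    rw [Matrix.mul_apply, Finset.sum_mul]
    refine Finset.sum_congr rfl fun i _ => ?_
    rw [Matrix.hadamard_apply, hQ, Matrix.conjTranspose_apply]
    ring
  have white : ∀ x y : Fin n_s × Fin n_r,
      ∫ ω, W ω x.2 x.1 * star (W ω y.2 y.1) ∂μ = if x = y then 1 else 0 := by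
    intro x y
    rw [hwhite]
    simp [Prod.ext_iff, and_comm]
  ext p q
  have correlation := integral_sum_mul_star_sum_of_white
    (ι := Fin n_s × Fin n_r) (w := fun x ω => W ω x.2 x.1)
    (fun x y => hint x.2 x.1 y.2 y.1) white
    (fun x => star (U_s p.1 x.1) * U_r p.2 x.2 * ((v_s x.1 : ℂ) * (v_r x.2 : ℂ)))
    (fun x => star (U_s q.1 x.1) * U_r q.2 x.2 * ((v_s x.1 : ℂ) * (v_r x.2 : ℂ)))
  simp only [← entry] at correlation
  rw [Matrix.of_apply, correlation]
  rw [Matrix.diagonal_kronecker_diagonal, Matrix.mul_apply]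
  refine Finset.sum_congr rfl fun x _ => ?_
  rw [Matrix.mul_diagonal]
  simp only [Matrix.kroneckerMap_apply, Matrix.map_apply, Matrix.transpose_apply,
    Matrix.conjTranspose_apply, star_mul', Complex.star_def, Complex.conj_ofReal,
    Complex.conj_conj]
  ring
end

section
/- Let U_r be a deterministic N_r × n_r complex matrix with U_rᴴ·U_r = I_{n_r}, U_s a deterministic N_s × n_s complex matrix, and H(ω) = U_r · (Q ⊙ W(ω)) · U_sᴴ. Then the entrywise expectation of Hᴴ·H satisfies E[Hᴴ·H] = (Σ_{i ∈ Fin n_r} (v_r i)²) · U_s · diag(v_s⊙v_s) · U_sᴴ. -/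
open MeasureTheory Matrix
open scoped Matrix

/-- Entrywise integration commutes with multiplication by constant matrices on both sides. -/
theorem integral_mul_mul_apply {Ω k l m n : Type*} [MeasurableSpace Ω] {μ : Measure Ω}
    [Fintype l] [Fintype m] (A : Matrix k l ℂ) (X : Ω → Matrix l m ℂ) (B : Matrix m n ℂ)
    (hX : ∀ i j, Integrable (fun ω => X ω i j) μ) (a : k) (b : n) :
    ∫ ω, (A * X ω * B) a b ∂μ = (A * (Matrix.of fun i j => ∫ ω, X ω i j ∂μ) * B) a b := by
  simp only [Matrix.mul_apply, Matrix.of_apply]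
  rw [integral_finsetSum _ fun j _ =>
    (integrable_finsetSum _ fun i _ => (hX i j).const_mul _).mul_const _]
  refine Finset.sum_congr rfl fun j _ => ?_
  rw [integral_mul_const, integral_finsetSum _ fun i _ => (hX i j).const_mul _]
  simp only [integral_const_mul]

theorem conjTranspose_mul_self_hadamard_apply {m n : Type*} [Fintype m]
    (Q W : Matrix m n ℂ) (j l : n) :
    ((Q ⊙ W)ᴴ * (Q ⊙ W)) j l = ∑ i, star (Q i j) * Q i l * (W i l * star (W i j)) := by
  simp only [Matrix.mul_apply, Matrix.conjTranspose_apply, Matrix.hadamard_apply, star_mul]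
  exact Finset.sum_congr rfl fun i _ => by ring

theorem conjTranspose_mul_self_of_isometry {k l m n : Type*} [Fintype k] [Fintype l] [Fintype m]
    [DecidableEq l] (U : Matrix k l ℂ) (hU : Uᴴ * U = 1) (M : Matrix l m ℂ) (V : Matrix n m ℂ) :
    (U * M * Vᴴ)ᴴ * (U * M * Vᴴ) = V * (Mᴴ * M) * Vᴴ := by
  simp only [Matrix.conjTranspose_mul, Matrix.conjTranspose_conjTranspose, Matrix.mul_assoc]
  rw [← Matrix.mul_assoc Uᴴ U, hU, Matrix.one_mul]

/-- UE-side Gram expectation: for `H(ω) = U_r (Q ⊙ W(ω)) U_sᴴ` with `U_rᴴ U_r = I`,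
`E[Hᴴ H] = (Σ_i (v_r i)²) · U_s diag(v_s⊙v_s) U_sᴴ` (expectation entrywise). -/
theorem gram_expectation_ue_side
    {Ω : Type*} [MeasurableSpace Ω] (μ : Measure Ω) [IsProbabilityMeasure μ]
    {n_r n_s N_r N_s : ℕ} (v_r : Fin n_r → ℝ) (v_s : Fin n_s → ℝ)
    (Q : Matrix (Fin n_r) (Fin n_s) ℂ)
    (hQ : ∀ i j, Q i j = (v_r i : ℂ) * (v_s j : ℂ))
    (W : Ω → Matrix (Fin n_r) (Fin n_s) ℂ)
    (hmeas : ∀ i j, Measurable fun ω => W ω i j)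
    (hint : ∀ i j k l, Integrable (fun ω => W ω i j * star (W ω k l)) μ)
    (hwhite : ∀ i j k l,
      ∫ ω, W ω i j * star (W ω k l) ∂μ = if (i, j) = (k, l) then 1 else 0)
    (U_r : Matrix (Fin N_r) (Fin n_r) ℂ) (U_s : Matrix (Fin N_s) (Fin n_s) ℂ)
    (hUr : U_rᴴ * U_r = 1)
    (H : Ω → Matrix (Fin N_r) (Fin N_s) ℂ)
    (hH : ∀ ω, H ω = U_r * (Q ⊙ W ω) * U_sᴴ) :
    (Matrix.of fun j l => ∫ ω, ((H ω)ᴴ * H ω) j l ∂μ) =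
      (∑ i, (v_r i : ℂ) ^ 2) •
        (U_s * Matrix.diagonal (fun j => (v_s j : ℂ) ^ 2) * U_sᴴ) := by
  have hX : ∀ j l, Integrable (fun ω => ((Q ⊙ W ω)ᴴ * (Q ⊙ W ω)) j l) μ := fun j l => by
    simp only [conjTranspose_mul_self_hadamard_apply]
    exact integrable_finsetSum _ fun i _ => (hint i l i j).const_mul _
  have hE : (Matrix.of fun j l => ∫ ω, ((Q ⊙ W ω)ᴴ * (Q ⊙ W ω)) j l ∂μ) =
      (∑ i, (v_r i : ℂ) ^ 2) • Matrix.diagonal (fun j => (v_s j : ℂ) ^ 2) := by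
    ext j l
    simp only [Matrix.of_apply, conjTranspose_mul_self_hadamard_apply]
    rw [integral_finsetSum _ fun i _ => (hint i l i j).const_mul _]
    simp only [integral_const_mul, hwhite, Matrix.smul_apply, Matrix.diagonal_apply, hQ]
    by_cases h : j = l
    · subst h
      simp only [if_true, smul_eq_mul, Finset.sum_mul, mul_one]
      refine Finset.sum_congr rfl fun i _ => ?_
      simp only [star_mul', Complex.star_def, Complex.conj_ofReal]
      ring
    · simp [h, Ne.symm h]
  ext j l
  simp only [Matrix.of_apply, hH, conjTranspose_mul_self_of_isometry U_r hUr]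
  rw [integral_mul_mul_apply _ _ _ hX, hE, Matrix.mul_smul, Matrix.smul_mul]
end

section
/- For each m ∈ Fin M let β_m ≥ 0 be a real number, let U_{r,m} be a deterministic N_r × n_r complex matrix with U_{r,m}ᴴ·U_{r,m} = I_{n_r}, let v_{r,m} : Fin n_r → ℝ, let Q_m be the n_r × n_s matrix with entries Q_m i j = v_{r,m} i · v_s j, let W_m : Ω → Matrix (Fin n_r) (Fin n_s) ℂ be white random matrices (as defined below), and set H_m(ω) = U_{r,m}·(Q_m ⊙ W_m(ω))·U_sᴴ and G_m(ω) = β_m · H_m(ω). Then, with MR combining V_m = G_m, the expected signal matrix satisfies Σ_{m ∈ Fin M} E[V_mᴴ·G_m] = (Σ_{m ∈ Fin M} β_m² · Σ_{i ∈ Fin n_r} (v_{r,m} i)²) · U_s · diag(v_s⊙v_s) · U_sᴴ. -/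
open MeasureTheory Matrix
open scoped Matrix

/-- If `A` has orthonormal columns, it drops out of the Gram matrix of `A * X * Bᴴ`. -/
theorem Matrix.gram_mul_mul_conjTranspose {k l m n R : Type*} [Fintype k] [Fintype l] [Fintype m]
    [DecidableEq l] [CommRing R] [StarRing R] {A : Matrix k l R} (hA : Aᴴ * A = 1)
    (X : Matrix l m R) (B : Matrix n m R) :
    (A * X * Bᴴ)ᴴ * (A * X * Bᴴ) = B * (Xᴴ * X) * Bᴴ := by
  calc (A * X * Bᴴ)ᴴ * (A * X * Bᴴ) = B * (Xᴴ * (Aᴴ * A) * X) * Bᴴ := by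
        simp only [conjTranspose_mul, conjTranspose_conjTranspose, Matrix.mul_assoc]
    _ = B * (Xᴴ * X) * Bᴴ := by rw [hA, Matrix.mul_one]

/-- Entrywise expectation commutes with multiplication by deterministic matrices. -/
theorem Matrix.of_integral_mul_mul {Ω k l m n : Type*} [Fintype l] [Fintype m]
    [MeasurableSpace Ω] {μ : Measure Ω} (A : Matrix k l ℂ) {X : Ω → Matrix l m ℂ}
    (B : Matrix m n ℂ) (hX : ∀ i j, Integrable (fun ω => X ω i j) μ) :
    (Matrix.of fun i j => ∫ ω, (A * X ω * B) i j ∂μ) =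
      A * (Matrix.of fun i j => ∫ ω, X ω i j ∂μ) * B := by
  ext i j
  simp only [Matrix.of_apply, Matrix.mul_apply]
  rw [integral_finsetSum _ fun q _ =>
    (integrable_finsetSum _ fun p _ => (hX p q).const_mul _).mul_const _]
  refine Finset.sum_congr rfl fun q _ => ?_
  rw [integral_mul_const, integral_finsetSum _ fun p _ => (hX p q).const_mul _]
  simp only [integral_const_mul]

theorem Matrix.gram_hadamard_apply {m n R : Type*} [Fintype m] [CommRing R] [StarRing R]
    (Q W : Matrix m n R) (j l : n) :
    ((Q ⊙ W)ᴴ * (Q ⊙ W)) j l = ∑ i, star (Q i j) * Q i l * (W i l * star (W i j)) := by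
  simp only [mul_apply, conjTranspose_apply, hadamard_apply, star_mul']
  exact Finset.sum_congr rfl fun i _ => by ring

theorem Matrix.integrable_gram_hadamard {Ω m n : Type*} [Fintype m] [MeasurableSpace Ω]
    {μ : Measure Ω} (Q : Matrix m n ℂ) {W : Ω → Matrix m n ℂ}
    (hint : ∀ i j k l, Integrable (fun ω => W ω i j * star (W ω k l)) μ) (j l : n) :
    Integrable (fun ω => ((Q ⊙ W ω)ᴴ * (Q ⊙ W ω)) j l) μ := by
  simp only [gram_hadamard_apply]
  exact integrable_finsetSum _ fun i _ => (hint i l i j).const_mul _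

/-- The expected Gram matrix of a white random matrix with a deterministic entrywise profile is
diagonal. -/
theorem Matrix.of_integral_gram_hadamard {Ω m n : Type*} [Fintype m] [DecidableEq m]
    [DecidableEq n] [MeasurableSpace Ω] {μ : Measure Ω} (Q : Matrix m n ℂ)
    {W : Ω → Matrix m n ℂ}
    (hint : ∀ i j k l, Integrable (fun ω => W ω i j * star (W ω k l)) μ)
    (hwhite : ∀ i j k l,
      ∫ ω, W ω i j * star (W ω k l) ∂μ = if (i, j) = (k, l) then 1 else 0) :
    (Matrix.of fun j l => ∫ ω, ((Q ⊙ W ω)ᴴ * (Q ⊙ W ω)) j l ∂μ) =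
      diagonal fun j => ∑ i, star (Q i j) * Q i j := by
  ext j l
  simp only [of_apply, gram_hadamard_apply]
  rw [integral_finsetSum _ fun i _ => (hint i l i j).const_mul _]
  simp only [integral_const_mul, hwhite]
  rcases eq_or_ne j l with rfl | h
  · simp
  · simp [h, h.symm]

/-- Closed-form expected signal matrix under MR combining `V_m = G_m`, with
`G_m(ω) = β_m · U_{r,m} (Q_m ⊙ W_m(ω)) U_sᴴ` and `U_{r,m}ᴴ U_{r,m} = I`:
`Σ_m E[V_mᴴ G_m] = (Σ_m β_m² Σ_i (v_{r,m} i)²) · U_s diag(v_s⊙v_s) U_sᴴ`. -/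
theorem mr_combining_signal_matrix
    {Ω : Type*} [MeasurableSpace Ω] (μ : Measure Ω) [IsProbabilityMeasure μ]
    {M n_r n_s N_r N_s : ℕ}
    (β : Fin M → ℝ) (hβ : ∀ m, 0 ≤ β m)
    (v_s : Fin n_s → ℝ) (U_s : Matrix (Fin N_s) (Fin n_s) ℂ)
    (U_r : Fin M → Matrix (Fin N_r) (Fin n_r) ℂ)
    (hUr : ∀ m, (U_r m)ᴴ * U_r m = 1)
    (v_r : Fin M → Fin n_r → ℝ)
    (Q : Fin M → Matrix (Fin n_r) (Fin n_s) ℂ)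
    (hQ : ∀ m i j, Q m i j = (v_r m i : ℂ) * (v_s j : ℂ))
    (W : Fin M → Ω → Matrix (Fin n_r) (Fin n_s) ℂ)
    (hmeas : ∀ m i j, Measurable fun ω => W m ω i j)
    (hint : ∀ m i j k l, Integrable (fun ω => W m ω i j * star (W m ω k l)) μ)
    (hwhite : ∀ m i j k l,
      ∫ ω, W m ω i j * star (W m ω k l) ∂μ = if (i, j) = (k, l) then 1 else 0)
    (H G V : Fin M → Ω → Matrix (Fin N_r) (Fin N_s) ℂ)
    (hH : ∀ m ω, H m ω = U_r m * (Q m ⊙ W m ω) * U_sᴴ)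
    (hG : ∀ m ω, G m ω = (β m : ℂ) • H m ω)
    (hV : ∀ m ω, V m ω = G m ω) :
    (∑ m, Matrix.of fun j l => ∫ ω, ((V m ω)ᴴ * G m ω) j l ∂μ) =
      ((∑ m, (β m : ℂ) ^ 2 * ∑ i, (v_r m i : ℂ) ^ 2)) •
        (U_s * Matrix.diagonal (fun j => (v_s j : ℂ) ^ 2) * U_sᴴ) := by
  have key : ∀ m, (Matrix.of fun j l => ∫ ω, ((V m ω)ᴴ * G m ω) j l ∂μ) =
      ((β m : ℂ) ^ 2 * ∑ i, (v_r m i : ℂ) ^ 2) •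
        (U_s * Matrix.diagonal (fun j => (v_s j : ℂ) ^ 2) * U_sᴴ) := by
    intro m
    have hgram : ∀ ω, (V m ω)ᴴ * G m ω =
        ((β m : ℂ) ^ 2 • U_s) * ((Q m ⊙ W m ω)ᴴ * (Q m ⊙ W m ω)) * U_sᴴ := by
      intro ω
      rw [hV, hG, hH, conjTranspose_smul, Matrix.smul_mul, Matrix.mul_smul,
        gram_mul_mul_conjTranspose (hUr m), smul_smul, Matrix.smul_mul, Matrix.smul_mul, sq]
      simp
    have hdiag : (diagonal fun j => ∑ i, star (Q m i j) * Q m i j) =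
        (∑ i, (v_r m i : ℂ) ^ 2) • diagonal fun j => (v_s j : ℂ) ^ 2 := by
      rw [← diagonal_smul]
      congr 1
      ext j
      simp only [hQ, Pi.smul_apply, smul_eq_mul, Finset.sum_mul]
      refine Finset.sum_congr rfl fun i _ => ?_
      simp only [star_mul', Complex.star_def, Complex.conj_ofReal]
      ring
    simp only [hgram]
    rw [of_integral_mul_mul _ _ (integrable_gram_hadamard (Q m) (hint m)),
      of_integral_gram_hadamard (Q m) (hint m) (hwhite m), hdiag, Matrix.smul_mul,
      Matrix.mul_smul, Matrix.smul_mul, Matrix.smul_mul, smul_smul]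
  simp only [key, Finset.sum_smul]
end
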